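/- Let Λ be an artin algebra with radical J, e an idempotent of Λ such that S_e = eΛ/eJ has finite injective dimension, and a ∈ J a nilpotent element. Consider the filtration Mᵢ = aⁱΛ of the regular module. Then the e-trace of left multiplication by a on Λ is zero in HH₀(Λ_e); consequently a + Λ(1−e)Λ lies in [Λ_e, Λ_e]. -/

import Mathlib

/-- The commutator subgroup [R,R]: additive subgroup generated by ab - ba. -/
def commSub (R : Type*) [Ring R] : AddSubgroup R :=
  AddSubgroup.closure {x | ∃ a b : R, x = a * b - b * a}

/-- The zeroth Hochschild homology HH₀(R) = R/[R,R]. -/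
abbrev HH0 (R : Type*) [Ring R] := R ⧸ commSub R

/-- Class of an element of R in HH₀(R). -/
def HH0.mk {R : Type*} [Ring R] (a : R) : HH0 R := QuotientAddGroup.mk a

/-- The group homomorphism HH₀(R) → HH₀(S) induced by a ring homomorphism. -/
def HH0.map {R S : Type*} [Ring R] [Ring S] (f : R →+* S) : HH0 R →+ HH0 S :=
  QuotientAddGroup.map _ _ f.toAddMonoidHom (by
    refine (AddSubgroup.closure_le _).mpr ?_
    rintro x ⟨a, b, rfl⟩
    simp only [AddSubgroup.coe_comap, Set.mem_preimage, RingHom.toAddMonoidHom_eq_coe,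
      AddMonoidHom.coe_coe, map_sub, map_mul, SetLike.mem_coe]
    exact AddSubgroup.subset_closure ⟨f a, f b, rfl⟩)

/-- The quotient ring Λ_e = Λ/Λ(1-e)Λ. -/
abbrev corner (Λ : Type*) [Ring Λ] (e : Λ) :=
  (TwoSidedIdeal.span {1 - e}).ringCon.Quotient

/-- The canonical projection Λ → Λ_e. -/
abbrev cornerProj (Λ : Type*) [Ring Λ] (e : Λ) : Λ →+* corner Λ e :=
  (TwoSidedIdeal.span {1 - e}).ringCon.mk'

/-- The Jacobson radical of Λ, via the classical characterization:
x ∈ J(Λ) iff 1 - yx is invertible for every y. -/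
def Jset (Λ : Type*) [Ring Λ] : Set Λ := {x | ∀ y : Λ, IsUnit (1 - y * x)}

/-- The right Λ-module e₁Λ ⊕ ⋯ ⊕ e_rΛ, realized as a Λᵐᵒᵖ-submodule of Λʳ. -/
def stdProj {Λ : Type*} [Ring Λ] {r : ℕ} (e : Fin r → Λ) : Submodule Λᵐᵒᵖ (Fin r → Λ) where
  carrier := {x | ∀ j, e j * x j = x j}
  add_mem' := by
    intro x y hx hy j
    simp only [Pi.add_apply, mul_add, hx j, hy j]
  zero_mem' := by intro j; simp
  smul_mem' := by
    intro c x hx j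
    simp only [Pi.smul_apply, MulOpposite.smul_eq_mul_unop, ← mul_assoc, hx j]

/-- The canonical generator of the j-th summand e_jΛ of e₁Λ ⊕ ⋯ ⊕ e_rΛ. -/
def stdBasis {Λ : Type*} [Ring Λ] {r : ℕ} (e : Fin r → Λ)
    (he : ∀ j, IsIdempotentElem (e j)) (j : Fin r) : stdProj e :=
  ⟨fun i => if i = j then e j else 0, by
    intro i
    by_cases h : i = j
    · subst h; simp; exact he i
    · simp [h]⟩

/-- The Hattori–Stallings trace of an endomorphism of P = e₁Λ ⊕ ⋯ ⊕ e_rΛ :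
the class in HH₀(Λ) of the sum of the diagonal entries of its representing matrix. -/
def trP {Λ : Type*} [Ring Λ] {r : ℕ} {e : Fin r → Λ} (he : ∀ j, IsIdempotentElem (e j))
    (φ : stdProj e →ₗ[Λᵐᵒᵖ] stdProj e) : HH0 Λ :=
  HH0.mk (∑ j, (φ (stdBasis e he j) : Fin r → Λ) j)

/-- A projective resolution of a right Λ-module M by finite direct sums of modules
of the form eΛ with e idempotent. -/
structure StdRes (Λ : Type*) [Ring Λ] (M : Type*) [AddCommGroup M] [Module Λᵐᵒᵖ M] where
  n : ℕ → ℕ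
  E : (i : ℕ) → Fin (n i) → Λ
  idem : ∀ i j, IsIdempotentElem (E i j)
  d : (i : ℕ) → (stdProj (E (i+1)) →ₗ[Λᵐᵒᵖ] stdProj (E i))
  aug : stdProj (E 0) →ₗ[Λᵐᵒᵖ] M
  surj : Function.Surjective aug
  exact0 : LinearMap.ker aug = LinearMap.range (d 0)
  exact : ∀ i, LinearMap.ker (d i) = LinearMap.range (d (i+1))

/-- A projective resolution is e-bounded if e annihilates the tops of all but finitely
many of its terms, i.e. for all large i the top of each summand E i j · Λ is killed by
right multiplication by e (equivalently E i j · Λ · e ⊆ E i j · J). -/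
def StdRes.EBounded {Λ : Type*} [Ring Λ] {M : Type*} [AddCommGroup M] [Module Λᵐᵒᵖ M]
    (e : Λ) (R : StdRes Λ M) : Prop :=
  ∃ N : ℕ, ∀ i ≥ N, ∀ j, ∀ x : Λ, R.E i j * x * e ∈ Jset Λ

/-- A lifting {φᵢ} of an endomorphism φ of M to a projective resolution of M. -/
def StdRes.IsLifting {Λ : Type*} [Ring Λ] {M : Type*} [AddCommGroup M] [Module Λᵐᵒᵖ M]
    (R : StdRes Λ M) (φ : M →ₗ[Λᵐᵒᵖ] M)
    (L : (i : ℕ) → (stdProj (R.E i) →ₗ[Λᵐᵒᵖ] stdProj (R.E i))) : Prop :=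
  (∀ x, R.aug (L 0 x) = φ (R.aug x)) ∧
  ∀ i, ∀ x, R.d i (L (i+1) x) = L i (R.d i x)

/-- The alternating sum Σᵢ (-1)ⁱ tr_e(φᵢ) ∈ HH₀(Λ_e) attached to a lifting {φᵢ}. -/
noncomputable def eTraceSum {Λ : Type*} [Ring Λ] {M : Type*} [AddCommGroup M]
    [Module Λᵐᵒᵖ M] (e : Λ) (R : StdRes Λ M)
    (L : (i : ℕ) → (stdProj (R.E i) →ₗ[Λᵐᵒᵖ] stdProj (R.E i))) : HH0 (corner Λ e) :=
  ∑ᶠ i : ℕ, ((-1 : ℤ)^i) • HH0.map (cornerProj Λ e) (trP (R.idem i) (L i))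

universe u

/-- The right ideal eΛ as a Λᵐᵒᵖ-submodule of Λ. -/
def eSub (Λ : Type*) [Ring Λ] (e : Λ) : Submodule Λᵐᵒᵖ Λ where
  carrier := {x | e * x = x}
  add_mem' := by intro x y hx hy; simp only [Set.mem_setOf_eq] at *; rw [mul_add, hx, hy]
  zero_mem' := by simp
  smul_mem' := by
    intro c x hx
    simp only [Set.mem_setOf_eq, MulOpposite.smul_eq_mul_unop, ← mul_assoc] at *
    rw [hx]

/-- The semisimple right Λ-module S_e = eΛ/eJ. -/
abbrev SeMod (Λ : Type*) [Ring Λ] (e : Λ) :=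
  (eSub Λ e) ⧸ (Submodule.span Λᵐᵒᵖ {x : eSub Λ e | (x : Λ) ∈ Jset Λ})

/-- A right Λ-module M has finite injective dimension: it admits a finite injective
coresolution 0 → M → I⁰ → I¹ → ⋯ with Iⁱ = 0 for all large i. -/
def FinInjDim (Λ : Type u) [Ring Λ] (M : Type u) [AddCommGroup M] [Module Λᵐᵒᵖ M] : Prop :=
  ∃ (I : ℕ → ModuleCat.{u} Λᵐᵒᵖ) (f : ∀ i, I i →ₗ[Λᵐᵒᵖ] I (i+1)) (g : M →ₗ[Λᵐᵒᵖ] I 0),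
    (∀ i, Module.Injective Λᵐᵒᵖ (I i)) ∧ Function.Injective g ∧
    LinearMap.ker (f 0) = LinearMap.range g ∧
    (∀ i, LinearMap.ker (f (i+1)) = LinearMap.range (f i)) ∧
    ∃ N, ∀ i ≥ N, Subsingleton (I i)

/-- Left multiplication by a, as an endomorphism of Λ as a right Λ-module. -/
def leftMulMap (Λ : Type*) [Ring Λ] (a : Λ) : Λ →ₗ[Λᵐᵒᵖ] Λ where
  toFun x := a * x
  map_add' x y := mul_add a x y
  map_smul' c x := by
    simp only [MulOpposite.smul_eq_mul_unop, RingHom.id_apply, mul_assoc]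


/-! ### Dependent choice along ℕ -/

theorem dep_seq {α : ℕ → Type*} (R : ∀ i, α i → α (i+1) → Prop)
    (h : ∀ i a, ∃ b, R i a b) (a0 : α 0) :
    ∃ s : ∀ i, α i, s 0 = a0 ∧ ∀ i, R i (s i) (s (i+1)) := by
  choose f hf using h
  exact ⟨fun i => Nat.rec a0 (fun i a => f i a) i, rfl, fun i => hf i _⟩

section Traces

variable {Λ : Type u} [Ring Λ]

/-- The standard expansion of a vector in Λⁿ. -/
theorem vec_expand {n : ℕ} (x : Fin n → Λ) :
    x = ∑ j, MulOpposite.op (x j) • (Pi.single j (1 : Λ) : Fin n → Λ) := by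
  ext i
  simp [Finset.sum_apply, Pi.single_apply]

/-- Linear maps on retracts of free modules can be lifted. -/
theorem retract_lift {n : ℕ} {V : Submodule Λᵐᵒᵖ (Fin n → Λ)}
    (r : (Fin n → Λ) →ₗ[Λᵐᵒᵖ] V) (hr : ∀ x : V, r x = x)
    {A B : Type*} [AddCommGroup A] [Module Λᵐᵒᵖ A] [AddCommGroup B] [Module Λᵐᵒᵖ B]
    (p : A →ₗ[Λᵐᵒᵖ] B) (h : V →ₗ[Λᵐᵒᵖ] B) (hp : ∀ x, ∃ y, p y = h x) :
    ∃ l : V →ₗ[Λᵐᵒᵖ] A, ∀ x, p (l x) = h x := by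
  choose y hy using fun j : Fin n => hp (r (Pi.single j 1))
  refine ⟨{ toFun := fun x => ∑ j, MulOpposite.op ((x : Fin n → Λ) j) • y j
            map_add' := ?_, map_smul' := ?_ }, ?_⟩
  · intro a b
    simp [add_smul, Finset.sum_add_distrib]
  · intro c a
    simp [Finset.smul_sum, mul_smul]
  · intro x
    simp only [LinearMap.coe_mk, AddHom.coe_mk, map_sum, map_smul, hy]
    conv_rhs => rw [← hr x, vec_expand (x : Fin n → Λ)]
    simp only [map_sum, map_smul]

/-- e-trace of an endomorphism of a retract V of Λⁿ. -/
def trV (e : Λ) {n : ℕ} {V : Submodule Λᵐᵒᵖ (Fin n → Λ)}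
    (r : (Fin n → Λ) →ₗ[Λᵐᵒᵖ] V) (φ : V →ₗ[Λᵐᵒᵖ] V) : HH0 (corner Λ e) :=
  HH0.mk (∑ j, cornerProj Λ e ((φ (r (Pi.single j 1)) : Fin n → Λ) j))

theorem HH0.mk_add {R : Type*} [Ring R] (a b : R) : HH0.mk (a + b) = HH0.mk a + HH0.mk b := rfl

theorem HH0.mk_sub {R : Type*} [Ring R] (a b : R) : HH0.mk (a - b) = HH0.mk a - HH0.mk b := rfl

theorem HH0.mk_zero {R : Type*} [Ring R] : HH0.mk (0 : R) = 0 := rfl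

theorem HH0.mk_mul_comm {R : Type*} [Ring R] (a b : R) : HH0.mk (a * b) = HH0.mk (b * a) := by
  rw [← sub_eq_zero, ← HH0.mk_sub]
  exact (QuotientAddGroup.eq_zero_iff _).2 (AddSubgroup.subset_closure ⟨a, b, rfl⟩)

theorem HH0.mk_sum {R : Type*} [Ring R] {ι : Type*} (s : Finset ι) (f : ι → R) :
    HH0.mk (∑ i ∈ s, f i) = ∑ i ∈ s, HH0.mk (f i) :=
  map_sum (QuotientAddGroup.mk' (commSub R)) f s

theorem trV_sub (e : Λ) {n : ℕ} {V : Submodule Λᵐᵒᵖ (Fin n → Λ)}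
    (r : (Fin n → Λ) →ₗ[Λᵐᵒᵖ] V) (φ ψ : V →ₗ[Λᵐᵒᵖ] V) :
    trV e r (φ - ψ) = trV e r φ - trV e r ψ := by
  unfold trV
  rw [← HH0.mk_sub]
  simp [Finset.sum_sub_distrib]

theorem trV_add (e : Λ) {n : ℕ} {V : Submodule Λᵐᵒᵖ (Fin n → Λ)}
    (r : (Fin n → Λ) →ₗ[Λᵐᵒᵖ] V) (φ ψ : V →ₗ[Λᵐᵒᵖ] V) :
    trV e r (φ + ψ) = trV e r φ + trV e r ψ := by
  unfold trV
  rw [← HH0.mk_add]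
  simp [Finset.sum_add_distrib]

theorem trV_eq_zero (e : Λ) {n : ℕ} {V : Submodule Λᵐᵒᵖ (Fin n → Λ)}
    (r : (Fin n → Λ) →ₗ[Λᵐᵒᵖ] V) (φ : V →ₗ[Λᵐᵒᵖ] V)
    (h : ∀ x : V, ∀ j, cornerProj Λ e ((x : Fin n → Λ) j) = 0) : trV e r φ = 0 := by
  unfold trV
  rw [Finset.sum_eq_zero fun j _ => h _ j, HH0.mk_zero]

theorem comp_entry {n m : ℕ} {V : Submodule Λᵐᵒᵖ (Fin n → Λ)} {W : Submodule Λᵐᵒᵖ (Fin m → Λ)}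
    (r' : (Fin m → Λ) →ₗ[Λᵐᵒᵖ] W) (hr' : ∀ x : W, r' x = x)
    (g : W →ₗ[Λᵐᵒᵖ] V) (w : W) (j : Fin n) :
    ((g w : V) : Fin n → Λ) j =
      ∑ i, ((g (r' (Pi.single i 1)) : V) : Fin n → Λ) j * (w : Fin m → Λ) i := by
  conv_lhs => rw [← hr' w, vec_expand (w : Fin m → Λ)]
  simp [map_sum, map_smul, Finset.sum_apply]

theorem trV_comm (e : Λ) {n m : ℕ} {V : Submodule Λᵐᵒᵖ (Fin n → Λ)}
    {W : Submodule Λᵐᵒᵖ (Fin m → Λ)}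
    (r : (Fin n → Λ) →ₗ[Λᵐᵒᵖ] V) (hr : ∀ x : V, r x = x)
    (r' : (Fin m → Λ) →ₗ[Λᵐᵒᵖ] W) (hr' : ∀ x : W, r' x = x)
    (f : V →ₗ[Λᵐᵒᵖ] W) (g : W →ₗ[Λᵐᵒᵖ] V) :
    trV e r (g ∘ₗ f) = trV e r' (f ∘ₗ g) := by
  unfold trV
  have h1 : ∀ j, (((g ∘ₗ f) (r (Pi.single j 1)) : V) : Fin n → Λ) j = _ :=
    fun j => comp_entry r' hr' g (f (r (Pi.single j 1))) j
  have h2 : ∀ j, (((f ∘ₗ g) (r' (Pi.single j 1)) : W) : Fin m → Λ) j = _ :=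
    fun j => comp_entry r hr f (g (r' (Pi.single j 1))) j
  simp only [h1, h2, map_sum, map_mul, HH0.mk_sum]
  rw [Finset.sum_comm]
  refine Finset.sum_congr rfl fun i _ => Finset.sum_congr rfl fun j _ => ?_
  exact HH0.mk_mul_comm _ _

end Traces

section Resolutions

variable {Λ : Type u} [Ring Λ]

/-- Projective resolutions whose terms are retracts of finite free modules. -/
structure GRes (Λ : Type u) [Ring Λ] (M : Type u) [AddCommGroup M] [Module Λᵐᵒᵖ M] where
  n : ℕ → ℕ
  V : (i : ℕ) → Submodule Λᵐᵒᵖ (Fin (n i) → Λ)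
  r : (i : ℕ) → ((Fin (n i) → Λ) →ₗ[Λᵐᵒᵖ] V i)
  hr : ∀ i, ∀ x : V i, r i x = x
  d : (i : ℕ) → (V (i+1) →ₗ[Λᵐᵒᵖ] V i)
  aug : V 0 →ₗ[Λᵐᵒᵖ] M
  surj : Function.Surjective aug
  exact0 : LinearMap.ker aug = LinearMap.range (d 0)
  exact : ∀ i, LinearMap.ker (d i) = LinearMap.range (d (i+1))

variable {M N : Type u} [AddCommGroup M] [Module Λᵐᵒᵖ M] [AddCommGroup N] [Module Λᵐᵒᵖ N]

theorem GRes.dd (P : GRes Λ M) (i : ℕ) (x) : P.d i (P.d (i+1) x) = 0 := by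
  have : P.d (i+1) x ∈ LinearMap.ker (P.d i) := by rw [P.exact]; exact ⟨x, rfl⟩
  exact this

theorem GRes.augd (P : GRes Λ M) (x) : P.aug (P.d 0 x) = 0 := by
  have : P.d 0 x ∈ LinearMap.ker P.aug := by rw [P.exact0]; exact ⟨x, rfl⟩
  exact this

theorem GRes.ex (P : GRes Λ M) (i : ℕ) (x) (h : P.d i x = 0) : ∃ y, P.d (i+1) y = x := by
  have : x ∈ LinearMap.ker (P.d i) := h
  rw [P.exact] at this; exact this

theorem GRes.ex0 (P : GRes Λ M) (x) (h : P.aug x = 0) : ∃ y, P.d 0 y = x := by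
  have : x ∈ LinearMap.ker P.aug := h
  rw [P.exact0] at this; exact this

/-- Bounded by N: the terms in degree ≥ N vanish over Λ_e. -/
def GRes.Bdd (P : GRes Λ M) (e : Λ) (N : ℕ) : Prop :=
  ∀ i ≥ N, ∀ x : P.V i, ∀ j, cornerProj Λ e ((x : Fin (P.n i) → Λ) j) = 0

def IsLift (P : GRes Λ M) (Q : GRes Λ N) (φ : M →ₗ[Λᵐᵒᵖ] N)
    (L : (i : ℕ) → (P.V i →ₗ[Λᵐᵒᵖ] Q.V i)) : Prop :=
  (∀ x, Q.aug (L 0 x) = φ (P.aug x)) ∧ ∀ i, ∀ x, Q.d i (L (i+1) x) = L i (P.d i x)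

theorem exists_lift (P : GRes Λ M) (Q : GRes Λ N) (φ : M →ₗ[Λᵐᵒᵖ] N) :
    ∃ L, IsLift P Q φ L := by
  obtain ⟨F0, hF0⟩ := retract_lift (P.r 0) (P.hr 0) Q.aug (φ ∘ₗ P.aug) (fun x => Q.surj _)
  obtain ⟨s, hs0, hs⟩ := dep_seq
    (α := fun i => {F : P.V i →ₗ[Λᵐᵒᵖ] Q.V i // ∀ x, ∃ y, Q.d i y = F (P.d i x)})
    (fun i F G => ∀ x, Q.d i (G.1 x) = F.1 (P.d i x))
    (by
      rintro i ⟨F, hF⟩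
      obtain ⟨G, hG⟩ := retract_lift (P.r (i+1)) (P.hr (i+1)) (Q.d i) (F ∘ₗ P.d i) hF
      refine ⟨⟨G, fun x => Q.ex _ _ ?_⟩, hG⟩
      rw [hG]; simp [P.dd])
    ⟨F0, fun x => Q.ex0 _ (by rw [hF0]; simp [P.augd])⟩
  refine ⟨fun i => (s i).1, ?_, hs⟩
  intro x
  have : (s 0).1 = F0 := by rw [hs0]
  exact (congrArg (fun F : P.V 0 →ₗ[Λᵐᵒᵖ] Q.V 0 => Q.aug (F x)) this).trans (hF0 x)

theorem IsLift.comp {K : Type u} [AddCommGroup K] [Module Λᵐᵒᵖ K]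
    {P : GRes Λ M} {Q : GRes Λ N} {S : GRes Λ K} {φ : M →ₗ[Λᵐᵒᵖ] N} {ψ : N →ₗ[Λᵐᵒᵖ] K} {L L'}
    (h : IsLift P Q φ L) (h' : IsLift Q S ψ L') :
    IsLift P S (ψ ∘ₗ φ) (fun i => L' i ∘ₗ L i) := by
  refine ⟨fun x => ?_, fun i x => ?_⟩
  · simp [h'.1, h.1]
  · simp [h'.2, h.2]

theorem telescope {A : Type*} [AddCommGroup A] (T t : ℕ → A) (h0 : T 0 = t 0)
    (h : ∀ i, T (i+1) = t (i+1) + t i) (N : ℕ) :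
    ∑ i ∈ Finset.range (N+1), ((-1 : ℤ)^i) • T i = ((-1 : ℤ)^N) • t N := by
  induction N with
  | zero => simp [h0]
  | succ N ih =>
    rw [Finset.sum_range_succ, ih, h, smul_add, pow_succ]
    simp

/-- Homotopy invariance of the alternating trace. -/
theorem lift_trace_unique (e : Λ) (P : GRes Λ M) (K : ℕ) (hK : P.Bdd e K)
    (φ : M →ₗ[Λᵐᵒᵖ] M) (L L') (hL : IsLift P P φ L) (hL' : IsLift P P φ L') :
    ∑ i ∈ Finset.range K, ((-1 : ℤ)^i) • trV e (P.r i) (L i) =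
    ∑ i ∈ Finset.range K, ((-1 : ℤ)^i) • trV e (P.r i) (L' i) := by
  obtain ⟨s0, hs0⟩ := retract_lift (P.r 0) (P.hr 0) (P.d 0) (L 0 - L' 0)
    (fun x => P.ex0 _ (by simp [hL.1, hL'.1]))
  obtain ⟨s, hsz, hs⟩ := dep_seq
    (α := fun i => {F : P.V i →ₗ[Λᵐᵒᵖ] P.V (i+1) //
      ∀ x, P.d i (F (P.d i x)) = (L i - L' i) (P.d i x)})
    (fun i F G => ∀ x, P.d (i+1) (G.1 x) = (L (i+1) - L' (i+1) - F.1 ∘ₗ P.d i) x)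
    (by
      rintro i ⟨F, hF⟩
      obtain ⟨G, hG⟩ := retract_lift (P.r (i+1)) (P.hr (i+1)) (P.d (i+1))
        (L (i+1) - L' (i+1) - F ∘ₗ P.d i) (fun x => P.ex _ _ (by
          simp only [LinearMap.sub_apply, LinearMap.comp_apply, map_sub, hF, hL.2, hL'.2]
          simp))
      refine ⟨⟨G, fun x => ?_⟩, hG⟩
      rw [hG]; simp [P.dd])
    ⟨s0, fun x => hs0 _⟩
  rw [← sub_eq_zero, ← Finset.sum_sub_distrib,
    Finset.sum_congr rfl (g := fun i => ((-1 : ℤ)^i) • trV e (P.r i) (L i - L' i))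
      (fun i _ => by rw [trV_sub]; exact (zsmul_sub _ _ _).symm)]
  cases K with
  | zero => simp
  | succ K =>
    rw [telescope _ (fun i => trV e (P.r i) (P.d i ∘ₗ (s i).1))]
    · rw [trV_comm e (P.r K) (P.hr K) (P.r (K+1)) (P.hr (K+1)),
        trV_eq_zero e _ _ (hK _ le_rfl), smul_zero]
    · congr 1
      ext x : 1
      rw [LinearMap.comp_apply, hsz]; exact (hs0 x).symm
    · intro i
      rw [trV_comm e (P.r i) (P.hr i) (P.r (i+1)) (P.hr (i+1)), ← trV_add]
      congr 1
      ext x : 1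
      simp only [LinearMap.add_apply, LinearMap.comp_apply, hs i x]
      simp

/-- Cyclicity. -/
theorem trace_cyc (e : Λ) (P : GRes Λ M) (Q : GRes Λ N) (K : ℕ) (hP : P.Bdd e K) (hQ : Q.Bdd e K)
    (f : M →ₗ[Λᵐᵒᵖ] N) (g : N →ₗ[Λᵐᵒᵖ] M) (L L') (hL : IsLift P P (g ∘ₗ f) L)
    (hL' : IsLift Q Q (f ∘ₗ g) L') :
    ∑ i ∈ Finset.range K, ((-1 : ℤ)^i) • trV e (P.r i) (L i) =
    ∑ i ∈ Finset.range K, ((-1 : ℤ)^i) • trV e (Q.r i) (L' i) := by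
  obtain ⟨F, hF⟩ := exists_lift P Q f
  obtain ⟨G, hG⟩ := exists_lift Q P g
  rw [lift_trace_unique e P K hP _ _ _ hL (hF.comp hG),
    lift_trace_unique e Q K hQ _ _ _ hL' (hG.comp hF)]
  refine Finset.sum_congr rfl fun i _ => ?_
  rw [trV_comm e (P.r i) (P.hr i) (Q.r i) (Q.hr i)]

end Resolutions

section Existence

variable {Λ : Type u} [Ring Λ]

/-- A superfluous submodule. -/
def Superfl {R A : Type*} [Ring R] [AddCommGroup A] [Module R A] (K : Submodule R A) : Prop :=
  ∀ W : Submodule R A, W ⊔ K = ⊤ → W = ⊤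

theorem superfl_hom {R A S : Type*} [Ring R] [AddCommGroup A] [Module R A] [AddCommGroup S]
    [Module R S] [IsSemisimpleModule R S] (K : Submodule R A) (hK : Superfl K)
    (f : A →ₗ[R] S) (x : A) (hx : x ∈ K) : f x = 0 := by
  obtain ⟨C, hC⟩ := exists_isCompl (K.map f)
  have h1 : C.comap f ⊔ K = ⊤ := by
    rw [eq_top_iff]
    intro y _
    have : f y ∈ K.map f ⊔ C := by rw [hC.sup_eq_top]; trivial
    obtain ⟨_, ⟨z, hz, rfl⟩, c, hc, h⟩ := Submodule.mem_sup.1 this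
    refine Submodule.mem_sup.2 ⟨y - z, ?_, z, hz, by simp⟩
    change f (y - z) ∈ C
    rw [map_sub, ← h]; simpa using hc
  have h2 := hK _ h1
  have h3 : f x ∈ C := by
    have : x ∈ C.comap f := by rw [h2]; trivial
    exact this
  have h4 : f x ∈ K.map f ⊓ C := ⟨⟨x, hx, rfl⟩, h3⟩
  rw [hC.inf_eq_bot] at h4
  exact h4

/-- Existence of projective covers. -/
theorem exists_cover [∀ n : ℕ, IsNoetherian Λᵐᵒᵖ (Fin n → Λ)]
    [∀ n : ℕ, IsArtinian Λᵐᵒᵖ (Fin n → Λ)]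
    {M : Type*} [AddCommGroup M] [Module Λᵐᵒᵖ M] [Module.Finite Λᵐᵒᵖ M] :
    ∃ (n : ℕ) (V : Submodule Λᵐᵒᵖ (Fin n → Λ)) (r : (Fin n → Λ) →ₗ[Λᵐᵒᵖ] V)
      (p : V →ₗ[Λᵐᵒᵖ] M), (∀ x : V, r x = x) ∧ Function.Surjective p ∧
      Superfl (LinearMap.ker p) := by
  obtain ⟨n, y, hy⟩ := Module.Finite.exists_fin (R := Λᵐᵒᵖ) (M := M)
  let q : (Fin n → Λ) →ₗ[Λᵐᵒᵖ] M :=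
    { toFun := fun x => ∑ j, MulOpposite.op (x j) • y j
      map_add' := by intro a b; simp [add_smul, Finset.sum_add_distrib]
      map_smul' := by intro c a; simp [Finset.smul_sum, mul_smul] }
  have hq : Function.Surjective q := by
    rw [← LinearMap.range_eq_top, eq_top_iff, ← hy, Submodule.span_le]
    rintro _ ⟨j, rfl⟩
    exact ⟨Pi.single j 1, by simp [q, Pi.single_apply, apply_ite MulOpposite.op, ite_smul]⟩
  let U := LinearMap.ker q
  obtain ⟨V, hV, hmin⟩ := IsArtinian.set_has_minimal
    {V : Submodule Λᵐᵒᵖ (Fin n → Λ) | V ⊔ U = ⊤} ⟨⊤, top_sup_eq _⟩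
  replace hV : V ⊔ U = ⊤ := hV
  have hmin' : ∀ W ≤ V, W ⊔ U = ⊤ → W = V := fun W hW h => by
    by_contra hne
    exact hmin W h (lt_of_le_of_ne hW hne)
  have hqV : ∀ m, ∃ v : V, q v = m := fun m => by
    obtain ⟨x, rfl⟩ := hq m
    have : x ∈ V ⊔ U := by rw [hV]; trivial
    obtain ⟨v, hv, u, hu, rfl⟩ := Submodule.mem_sup.1 this
    exact ⟨⟨v, hv⟩, by simp [show q u = 0 from hu]⟩
  -- lift Λⁿ → M to h : Λⁿ → V
  obtain ⟨h, hh⟩ : ∃ h : (Fin n → Λ) →ₗ[Λᵐᵒᵖ] V, ∀ x, q (h x) = q x := by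
    obtain ⟨l, hl⟩ := retract_lift (V := (⊤ : Submodule Λᵐᵒᵖ (Fin n → Λ)))
      (LinearMap.id.codRestrict ⊤ (fun _ => trivial)) (fun x => rfl)
      (q ∘ₗ V.subtype) (q ∘ₗ Submodule.subtype _) (fun x => hqV _)
    exact ⟨l ∘ₗ LinearMap.id.codRestrict ⊤ (fun _ => trivial), fun x => hl _⟩
  have key : ∀ g : V →ₗ[Λᵐᵒᵖ] V, (∀ x : V, q (g x) = q x) → Function.Surjective g := by
    intro g hg
    have : (LinearMap.range g).map V.subtype = V := by
      refine hmin' _ (Submodule.map_subtype_le _ _) ?_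
      rw [eq_top_iff]
      intro x _
      obtain ⟨v, hv⟩ := hqV (q x)
      refine Submodule.mem_sup.2 ⟨(g v : V), ⟨g v, ⟨v, rfl⟩, rfl⟩, x - g v, ?_, by simp⟩
      change q (x - g v) = 0
      rw [map_sub, hg, hv, sub_self]
    intro v
    have hv : (v : Fin n → Λ) ∈ (LinearMap.range g).map V.subtype := by rw [this]; exact v.2
    obtain ⟨_, ⟨w, rfl⟩, hw⟩ := hv
    exact ⟨w, Subtype.ext hw⟩
  let g := h ∘ₗ V.subtype
  have hgs : Function.Surjective g := key g (fun x => hh x)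
  have hgb : Function.Bijective g := IsNoetherian.bijective_of_surjective_endomorphism g hgs
  let E := LinearEquiv.ofBijective g hgb
  refine ⟨n, V, E.symm.toLinearMap ∘ₗ h, q ∘ₗ V.subtype, ?_, ?_, ?_⟩
  · intro x
    change E.symm (g x) = x
    exact E.symm_apply_apply x
  · intro m; exact hqV m
  · intro W hW
    have : W.map V.subtype = V := by
      refine hmin' _ (Submodule.map_subtype_le _ _) ?_
      rw [eq_top_iff, ← hV]
      refine sup_le ?_ le_sup_right
      intro v hv
      have : (⟨v, hv⟩ : V) ∈ W ⊔ LinearMap.ker (q ∘ₗ V.subtype) := by rw [hW]; trivial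
      obtain ⟨w, hw, u, hu, h⟩ := Submodule.mem_sup.1 this
      exact Submodule.mem_sup.2 ⟨w, ⟨w, hw, rfl⟩, u, hu, congrArg Subtype.val h⟩
    rw [eq_top_iff]
    intro v _
    have hv : (v : Fin n → Λ) ∈ W.map V.subtype := by rw [this]; exact v.2
    obtain ⟨w, hw, hwv⟩ := hv
    exact (Subtype.ext hwv : w = v) ▸ hw

/-- Data of one step in a minimal projective resolution. -/
structure Stage (Λ : Type u) [Ring Λ] where
  n : ℕ
  V : Submodule Λᵐᵒᵖ (Fin n → Λ)
  r : (Fin n → Λ) →ₗ[Λᵐᵒᵖ] V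
  hr : ∀ x : V, r x = x
  K : Submodule Λᵐᵒᵖ V
  hK : Superfl K

theorem exists_minres [∀ n : ℕ, IsNoetherian Λᵐᵒᵖ (Fin n → Λ)]
    [∀ n : ℕ, IsArtinian Λᵐᵒᵖ (Fin n → Λ)]
    (M : Type u) [AddCommGroup M] [Module Λᵐᵒᵖ M] [Module.Finite Λᵐᵒᵖ M] :
    ∃ P : GRes Λ M, ∀ i, Superfl (LinearMap.range (P.d i)) := by
  obtain ⟨n, V, r, p, hr, hp, hs⟩ := exists_cover (Λ := Λ) (M := M)
  obtain ⟨s, hs0, hR⟩ := dep_seq (α := fun _ => Stage Λ)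
    (fun _ s t => ∃ d : t.V →ₗ[Λᵐᵒᵖ] s.V, LinearMap.range d = s.K ∧ LinearMap.ker d = t.K)
    (by
      intro _ s
      have : Module.Finite Λᵐᵒᵖ s.K := inferInstance
      obtain ⟨n, V, r, p, hr, hp, hs⟩ := exists_cover (Λ := Λ) (M := s.K)
      refine ⟨⟨n, V, r, hr, LinearMap.ker p, hs⟩, s.K.subtype ∘ₗ p, ?_, ?_⟩
      · rw [LinearMap.range_comp, LinearMap.range_eq_top.2 hp]; simp
      · rw [LinearMap.ker_comp]; simp)
    ⟨n, V, r, hr, LinearMap.ker p, hs⟩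
  choose d hd1 hd2 using hR
  obtain ⟨aug, ha1, ha2⟩ : ∃ aug : (s 0).V →ₗ[Λᵐᵒᵖ] M, Function.Surjective aug ∧
      LinearMap.ker aug = (s 0).K := by
    rw [hs0]; exact ⟨p, hp, rfl⟩
  exact ⟨{ n := fun i => (s i).n
           V := fun i => (s i).V
           r := fun i => (s i).r
           hr := fun i => (s i).hr
           d := d
           aug := aug
           surj := ha1
           exact0 := by rw [ha2, hd1]
           exact := fun i => by rw [hd2, hd1] }, fun i => by
             change Superfl (LinearMap.range (d i))
             rw [hd1]; exact (s i).hK⟩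

/-- Dimension shifting. -/
theorem ext_vanish {M : Type u} [AddCommGroup M] [Module Λᵐᵒᵖ M] (P : GRes Λ M)
    (I : ℕ → ModuleCat.{u} Λᵐᵒᵖ) (f : ∀ i, I i →ₗ[Λᵐᵒᵖ] I (i+1))
    (hI : ∀ i, Module.Injective Λᵐᵒᵖ (I i))
    (hf : ∀ i, LinearMap.ker (f (i+1)) = LinearMap.range (f i))
    (N : ℕ) (hN : ∀ i ≥ N, Subsingleton (I i)) (m : ℕ) :
    ∀ (i n : ℕ), N ≤ i + m → m ≤ n → ∀ h : P.V (n+1) →ₗ[Λᵐᵒᵖ] I i, (∀ x, f i (h x) = 0) →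
      (∀ x, h (P.d (n+1) x) = 0) →
      ∃ g : P.V n →ₗ[Λᵐᵒᵖ] I i, (∀ x, f i (g x) = 0) ∧ ∀ x, g (P.d n x) = h x := by
  induction m with
  | zero =>
    intro i n hi hn h _ _
    have := hN i (by omega)
    exact ⟨0, fun x => by simp, fun x => Subsingleton.elim _ _⟩
  | succ m ih =>
    intro i n hi hn h hfh hh
    obtain ⟨n, rfl⟩ : ∃ n', n = n' + 1 := ⟨n - 1, by omega⟩
    -- factor h through the range of d
    have hker : LinearMap.ker (P.d (n+1)) ≤ LinearMap.ker h := by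
      intro x hx
      obtain ⟨y, rfl⟩ := P.ex _ _ hx
      exact hh y
    obtain ⟨g, hg⟩ : ∃ g : P.V (n+1) →ₗ[Λᵐᵒᵖ] I i, ∀ x, g (P.d (n+1) x) = h x := by
      obtain ⟨g, hg⟩ := (hI i).out ((LinearMap.ker (P.d (n+1))).liftQ (P.d (n+1)) le_rfl)
        (LinearMap.ker_eq_bot.1 (Submodule.ker_liftQ_eq_bot' _ _ rfl))
        ((LinearMap.ker (P.d (n+1))).liftQ h hker)
      exact ⟨g, fun x => by simpa using hg (Submodule.Quotient.mk x)⟩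
    have hff : ∀ x, f (i+1) (f i x) = 0 := fun x => by
      have : f i x ∈ LinearMap.ker (f (i+1)) := by rw [hf]; exact ⟨x, rfl⟩
      exact this
    obtain ⟨g', hg'1, hg'2⟩ := ih (i+1) n (by omega) (by omega) (f i ∘ₗ g)
      (fun x => hff _) (fun x => by simp [hg, hfh])
    obtain ⟨u, hu⟩ := retract_lift (P.r n) (P.hr n) (f i) g' (fun x => by
      have : g' x ∈ LinearMap.ker (f (i+1)) := hg'1 x
      rw [hf] at this; exact this)
    refine ⟨g - u ∘ₗ P.d n, fun x => ?_, fun x => ?_⟩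
    · simp [hu, hg'2]
    · simp [hg, P.dd]

theorem hom_vanish {M S : Type u} [AddCommGroup M] [Module Λᵐᵒᵖ M] [AddCommGroup S]
    [Module Λᵐᵒᵖ S] [IsSemisimpleModule Λᵐᵒᵖ S] (hfin : FinInjDim Λ S)
    (P : GRes Λ M) (hP : ∀ i, Superfl (LinearMap.range (P.d i))) :
    ∃ N, ∀ i ≥ N, ∀ h : P.V i →ₗ[Λᵐᵒᵖ] S, h = 0 := by
  obtain ⟨I, f, g, hI, hg, hfg, hf, N, hN⟩ := hfin
  refine ⟨N + 1, fun i hi h => ?_⟩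
  obtain ⟨n, rfl⟩ : ∃ n', i = n' + 1 := ⟨i - 1, by omega⟩
  have hfg0 : ∀ x, f 0 (g x) = 0 := fun x => by
    have : g x ∈ LinearMap.ker (f 0) := by rw [hfg]; exact ⟨x, rfl⟩
    exact this
  obtain ⟨k, hk1, hk2⟩ := ext_vanish P I f hI hf N hN N 0 n (by omega) (by omega) (g ∘ₗ h)
    (fun x => hfg0 _) (fun x => by
      simp [superfl_hom _ (hP (n+1)) h (P.d (n+1) x) ⟨x, rfl⟩])
  obtain ⟨l, hl⟩ := retract_lift (P.r n) (P.hr n) g k (fun x => by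
    have : k x ∈ LinearMap.ker (f 0) := hk1 x
    rw [hfg] at this; exact this)
  ext x : 1
  apply hg
  have := hk2 x
  rw [← hl, superfl_hom _ (hP n) l (P.d n x) ⟨x, rfl⟩] at this
  rw [LinearMap.comp_apply] at this
  rw [← this]; simp

end Existence

section Final

variable {Λ : Type u} [Ring Λ]

theorem isUnit_swap (x y : Λ) (h : IsUnit (1 - x * y)) : IsUnit (1 - y * x) := by
  refine ⟨⟨1 - y * x, 1 + y * h.unit.inv * x, ?_, ?_⟩, rfl⟩
  · calc
      (1 - y * x) * (1 + y * (IsUnit.unit h).inv * x) =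
          1 - y * x + y * ((1 - x * y) * h.unit.inv) * x := by noncomm_ring
      _ = 1 := by simp only [Units.inv_eq_val_inv, IsUnit.mul_val_inv, mul_one, sub_add_cancel]
  · calc
      (1 + y * (IsUnit.unit h).inv * x) * (1 - y * x) =
          1 - y * x + y * (h.unit.inv * (1 - x * y)) * x := by noncomm_ring
      _ = 1 := by simp only [Units.inv_eq_val_inv, IsUnit.val_inv_mul, mul_one, sub_add_cancel]

theorem mem_jacobson_of_Jset (x : Λ) (hx : x ∈ Jset Λ) :
    MulOpposite.op x ∈ Ring.jacobson Λᵐᵒᵖ := by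
  rw [← Ideal.jacobson_bot, Ideal.mem_jacobson_iff]
  intro y
  have h := isUnit_swap _ _ (hx (-y.unop))
  obtain ⟨u, hu⟩ := h
  refine ⟨MulOpposite.op (↑u⁻¹ : Λ), ?_⟩
  have h2 : (u : Λ) * (↑u⁻¹ : Λ) = 1 := u.mul_inv
  rw [hu] at h2
  rw [Ideal.mem_bot]
  apply MulOpposite.unop_injective
  simp only [MulOpposite.unop_sub, MulOpposite.unop_add, MulOpposite.unop_mul,
    MulOpposite.unop_op, MulOpposite.unop_one, MulOpposite.unop_zero]
  rw [sub_eq_zero]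
  calc _ = (1 - x * -y.unop) * (↑u⁻¹ : Λ) := by noncomm_ring
    _ = 1 := h2

theorem Jset_of_mem_jacobson (x : Λᵐᵒᵖ) (hx : x ∈ Ring.jacobson Λᵐᵒᵖ) :
    x.unop ∈ Jset Λ := by
  intro y
  rw [← Ideal.jacobson_bot] at hx
  have key : ∀ w : Λᵐᵒᵖ, w ∈ (⊥ : Ideal Λᵐᵒᵖ).jacobson → ∃ z, z * (1 + w) = 1 := by
    intro w hw
    obtain ⟨z, hz⟩ := Ideal.mem_jacobson_iff.1 hw 1
    refine ⟨z, ?_⟩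
    rw [Ideal.mem_bot, sub_eq_zero] at hz
    rw [mul_one] at hz
    rw [mul_add, mul_one, add_comm, hz]
  -- all 1 + w with w in the radical are units
  have key2 : ∀ w : Λᵐᵒᵖ, w ∈ (⊥ : Ideal Λᵐᵒᵖ).jacobson → IsUnit (1 + w) := by
    intro w hw
    obtain ⟨z, hz⟩ := key w hw
    have hz1 : z = 1 + (-(z * w)) := by
      have h3 : z + z * w = 1 := by rw [← hz]; noncomm_ring
      rw [← h3]; abel
    obtain ⟨z', hz'⟩ := key (-(z * w)) (neg_mem (Ideal.mul_mem_left _ _ hw))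
    rw [← hz1] at hz'
    have : z' = 1 + w := by
      calc z' = z' * (z * (1 + w)) := by rw [hz, mul_one]
        _ = (z' * z) * (1 + w) := by rw [mul_assoc]
        _ = 1 + w := by rw [hz', one_mul]
    rw [this] at hz'
    exact ⟨⟨1 + w, z, hz', hz⟩, rfl⟩
  have h1 := key2 (-(MulOpposite.op y * x)) (neg_mem (Ideal.mul_mem_left _ _ hx))
  have h2 : IsUnit (1 - x.unop * y) := by
    have := h1.unop
    simpa [sub_eq_add_neg] using this
  exact isUnit_swap _ _ h2

theorem SeMod_semisimple [IsSemiprimaryRing Λᵐᵒᵖ] (e : Λ) :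
    IsSemisimpleModule Λᵐᵒᵖ (SeMod Λ e) := by
  have h : Module.IsTorsionBySet Λᵐᵒᵖ (SeMod Λ e) (Ring.jacobson Λᵐᵒᵖ) := by
    rintro m ⟨y, hy⟩
    obtain ⟨x, rfl⟩ := Submodule.Quotient.mk_surjective _ m
    change y • Submodule.Quotient.mk x = (0 : SeMod Λ e)
    rw [← Submodule.Quotient.mk_smul, Submodule.Quotient.mk_eq_zero]
    refine Submodule.subset_span ?_
    have := Jset_of_mem_jacobson (y * MulOpposite.op (x : Λ)) (Ideal.mul_mem_right _ _ hy)
    exact this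
  let _ := h.module
  exact (h.semilinearMap.isSemisimpleModule_iff_of_bijective Function.bijective_id).2
    inferInstance

theorem corner_zero [∀ n : ℕ, IsNoetherian Λᵐᵒᵖ (Fin n → Λ)] [IsSemiprimaryRing Λᵐᵒᵖ]
    (e : Λ) (he : IsIdempotentElem e) {n : ℕ} (V : Submodule Λᵐᵒᵖ (Fin n → Λ))
    (hV : ∀ h : V →ₗ[Λᵐᵒᵖ] SeMod Λ e, h = 0) (x : V) (j : Fin n) :
    cornerProj Λ e ((x : Fin n → Λ) j) = 0 := by
  have hce : cornerProj Λ e (1 - e) = 0 := by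
    have : (1 - e) ∈ TwoSidedIdeal.span {1 - e} := TwoSidedIdeal.subset_span rfl
    rw [TwoSidedIdeal.mem_iff] at this
    exact ((RingCon.eq _).2 this)
  let W0 : Submodule Λᵐᵒᵖ V :=
    { carrier := {x | ∀ j, cornerProj Λ e ((x : Fin n → Λ) j) = 0}
      add_mem' := by
        intro a b ha hb j
        change cornerProj Λ e ((a : Fin n → Λ) j + (b : Fin n → Λ) j) = 0
        rw [map_add, ha j, hb j, add_zero]
      zero_mem' := fun j => map_zero _
      smul_mem' := by
        intro c a ha j
        change cornerProj Λ e ((a : Fin n → Λ) j * c.unop) = 0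
        rw [map_mul, ha j, zero_mul] }
  suffices W0 = ⊤ by
    have hx : x ∈ W0 := by rw [this]; trivial
    exact hx j
  by_contra hne
  obtain ⟨W, hW, hle⟩ := (eq_top_or_exists_le_coatom W0).resolve_left hne
  have hsimp : IsSimpleModule Λᵐᵒᵖ (V ⧸ W) := isSimpleModule_iff_isCoatom.2 hW
  obtain ⟨v, hv⟩ : ∃ v, v ∉ W := by
    by_contra hcon
    push Not at hcon
    exact hW.1 (eq_top_iff.2 fun v _ => hcon v)
  let t : V ⧸ W := Submodule.Quotient.mk v
  have ht : t ≠ 0 := fun h => hv ((Submodule.Quotient.mk_eq_zero _).1 h)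
  have hte : MulOpposite.op e • t = t := by
    change Submodule.Quotient.mk (MulOpposite.op e • v) = Submodule.Quotient.mk v
    rw [eq_comm, Submodule.Quotient.eq]
    apply hle
    intro j
    change cornerProj Λ e ((v : Fin n → Λ) j - (v : Fin n → Λ) j * e) = 0
    rw [show (v : Fin n → Λ) j - (v : Fin n → Λ) j * e = (v : Fin n → Λ) j * (1 - e) by
      noncomm_ring, map_mul, hce, mul_zero]
  let p : eSub Λ e →ₗ[Λᵐᵒᵖ] V ⧸ W :=
    { toFun := fun x => MulOpposite.op (x : Λ) • t
      map_add' := by intro a b; simp [add_smul]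
      map_smul' := by intro c a; simp [mul_smul] }
  have hpJ : Submodule.span Λᵐᵒᵖ {x : eSub Λ e | (x : Λ) ∈ Jset Λ} ≤ LinearMap.ker p := by
    rw [Submodule.span_le]
    intro x hx
    have h1 := IsSemisimpleModule.jacobson_le_annihilator Λᵐᵒᵖ (V ⧸ W)
      (mem_jacobson_of_Jset _ hx)
    exact Module.mem_annihilator.1 h1 t
  let q : SeMod Λ e →ₗ[Λᵐᵒᵖ] V ⧸ W := Submodule.liftQ _ p hpJ
  have hqe : q (Submodule.Quotient.mk ⟨e, he⟩) = t := hte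
  have hq0 : q ≠ 0 := by
    intro h
    rw [h] at hqe
    exact ht hqe.symm
  have hqs : Function.Surjective q := LinearMap.surjective_of_ne_zero hq0
  have := SeMod_semisimple e
  obtain ⟨C, hC⟩ := exists_isCompl (LinearMap.ker q)
  obtain ⟨s, hs⟩ : ∃ s : (V ⧸ W) →ₗ[Λᵐᵒᵖ] SeMod Λ e, ∀ y, q (s y) = y := by
    have hb : Function.Bijective (q ∘ₗ C.subtype) := by
      constructor
      · rw [← LinearMap.ker_eq_bot, eq_bot_iff]
        intro c hc
        have : (c : SeMod Λ e) ∈ LinearMap.ker q ⊓ C := ⟨hc, c.2⟩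
        rw [hC.inf_eq_bot] at this
        exact Subtype.ext this
      · intro y
        obtain ⟨z, rfl⟩ := hqs y
        have : z ∈ LinearMap.ker q ⊔ C := by rw [hC.sup_eq_top]; trivial
        obtain ⟨u, hu, c, hc, rfl⟩ := Submodule.mem_sup.1 this
        exact ⟨⟨c, hc⟩, by simp [show q u = 0 from hu]⟩
    let E := LinearEquiv.ofBijective _ hb
    exact ⟨C.subtype ∘ₗ E.symm.toLinearMap, fun y => E.apply_symm_apply y⟩
  have h0 := hV (s ∘ₗ W.mkQ)
  apply ht
  rw [← hs t]
  have : s t = 0 := LinearMap.congr_fun h0 v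
  rw [this, map_zero]

theorem exists_bdd [∀ n : ℕ, IsNoetherian Λᵐᵒᵖ (Fin n → Λ)]
    [∀ n : ℕ, IsArtinian Λᵐᵒᵖ (Fin n → Λ)] [IsSemiprimaryRing Λᵐᵒᵖ]
    (e : Λ) (he : IsIdempotentElem e) (hfin : FinInjDim Λ (SeMod Λ e))
    (M : Type u) [AddCommGroup M] [Module Λᵐᵒᵖ M] [Module.Finite Λᵐᵒᵖ M] :
    ∃ (P : GRes Λ M) (K : ℕ), P.Bdd e K := by
  have := SeMod_semisimple e
  obtain ⟨P, hP⟩ := exists_minres (Λ := Λ) M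
  obtain ⟨N, hN⟩ := hom_vanish hfin P hP
  exact ⟨P, N, fun i hi x j => corner_zero e he _ (hN i hi) x j⟩

/-- Extending the range of summation. -/
theorem sum_extend {M : Type u} [AddCommGroup M] [Module Λᵐᵒᵖ M] (e : Λ) (P : GRes Λ M)
    (K K' : ℕ) (hK : P.Bdd e K) (h : K ≤ K') (L : (i : ℕ) → (P.V i →ₗ[Λᵐᵒᵖ] P.V i)) :
    ∑ i ∈ Finset.range K, ((-1 : ℤ)^i) • trV e (P.r i) (L i) =
    ∑ i ∈ Finset.range K', ((-1 : ℤ)^i) • trV e (P.r i) (L i) := by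
  refine Finset.sum_subset (by simpa using h) fun i _ hi => ?_
  rw [trV_eq_zero e _ _ (hK i (by simpa using hi)), smul_zero]

/-- Nilpotent endomorphisms have zero e-trace. -/
theorem nilp_trace_zero [∀ n : ℕ, IsNoetherian Λᵐᵒᵖ (Fin n → Λ)]
    [∀ n : ℕ, IsArtinian Λᵐᵒᵖ (Fin n → Λ)] [IsSemiprimaryRing Λᵐᵒᵖ]
    [IsNoetherianRing Λᵐᵒᵖ]
    (e : Λ) (he : IsIdempotentElem e) (hfin : FinInjDim Λ (SeMod Λ e)) (m : ℕ) :
    ∀ (M : Type u) [AddCommGroup M] [Module Λᵐᵒᵖ M] [Module.Finite Λᵐᵒᵖ M]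
      (φ : M →ₗ[Λᵐᵒᵖ] M), (∀ x, (φ^[m]) x = 0) → ∀ (P : GRes Λ M) (K : ℕ), P.Bdd e K →
      ∀ L, IsLift P P φ L →
      ∑ i ∈ Finset.range K, ((-1 : ℤ)^i) • trV e (P.r i) (L i) = 0 := by
  induction m with
  | zero =>
    intro M _ _ _ φ hφ P K hK L hL
    rw [lift_trace_unique e P K hK φ L (fun _ => 0) hL
      ⟨fun x => (hφ _).trans (hφ _).symm, fun i x => by simp⟩]
    refine Finset.sum_eq_zero fun i _ => ?_
    have : trV e (P.r i) 0 = 0 := by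
      unfold trV
      simp [HH0.mk_zero]
    rw [this, smul_zero]
  | succ m ih =>
    intro M _ _ _ φ hφ P K hK L hL
    have : Module.Finite Λᵐᵒᵖ (LinearMap.range φ) := inferInstance
    obtain ⟨Q, K', hQ⟩ := exists_bdd e he hfin (LinearMap.range φ)
    let ψ := φ.rangeRestrict ∘ₗ (LinearMap.range φ).subtype
    obtain ⟨L', hL'⟩ := exists_lift Q Q ψ
    have hψ : ∀ k, ∀ x : LinearMap.range φ, ((ψ^[k] x : LinearMap.range φ) : M) = φ^[k] x := by
      intro k
      induction k with
      | zero => intro x; rfl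
      | succ k ihk => intro x; rw [Function.iterate_succ_apply, ihk]; rfl
    have h1 := ih (LinearMap.range φ) ψ (fun x => by
      apply Subtype.ext
      rw [hψ]
      obtain ⟨_, y, rfl⟩ := x
      exact hφ y) Q (max K K') (fun i hi => hQ i (le_trans (le_max_right _ _) hi)) L' hL'
    rw [sum_extend e P K (max K K') hK (le_max_left _ _), ← h1]
    exact trace_cyc e P Q (max K K') (fun i hi => hK i (le_trans (le_max_left _ _) hi))
      (fun i hi => hQ i (le_trans (le_max_right _ _) hi)) φ.rangeRestrict
      (LinearMap.range φ).subtype L L' hL hL'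

/-- The canonical retraction of Λʳ on e₁Λ ⊕ ⋯ ⊕ e_rΛ. -/
def stdRetr {r : ℕ} (E : Fin r → Λ) (hE : ∀ j, IsIdempotentElem (E j)) :
    (Fin r → Λ) →ₗ[Λᵐᵒᵖ] stdProj E where
  toFun x := ⟨fun j => E j * x j, fun j => by rw [← mul_assoc, hE j]⟩
  map_add' a b := by
    apply Subtype.ext; funext j; exact mul_add _ _ _
  map_smul' c a := by
    apply Subtype.ext; funext j; exact (mul_assoc _ _ _).symm

/-- A StdRes is a GRes. -/
def StdRes.toGRes {M : Type u} [AddCommGroup M] [Module Λᵐᵒᵖ M] (R : StdRes Λ M) : GRes Λ M where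
  n := R.n
  V := fun i => stdProj (R.E i)
  r := fun i => stdRetr (R.E i) (R.idem i)
  hr := fun i x => Subtype.ext (funext fun j => x.2 j)
  d := R.d
  aug := R.aug
  surj := R.surj
  exact0 := R.exact0
  exact := R.exact

theorem trV_std (e : Λ) {r : ℕ} (E : Fin r → Λ) (hE : ∀ j, IsIdempotentElem (E j))
    (φ : stdProj E →ₗ[Λᵐᵒᵖ] stdProj E) :
    HH0.map (cornerProj Λ e) (trP hE φ) = trV e (stdRetr E hE) φ := by
  have h : ∀ j, stdRetr E hE (Pi.single j 1) = stdBasis E hE j := by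
    intro j
    apply Subtype.ext
    funext i
    change E i * (Pi.single j 1 : Fin r → Λ) i = if i = j then E j else 0
    by_cases hij : i = j
    · subst hij; simp
    · simp [hij]
  unfold trV trP
  simp only [h]
  rw [← map_sum]
  rfl

theorem idem_corner_zero (e E : Λ) (hE : IsIdempotentElem E) (h : E * e ∈ Jset Λ) :
    cornerProj Λ e E = 0 := by
  have hce : cornerProj Λ e (1 - e) = 0 := by
    have : (1 - e) ∈ TwoSidedIdeal.span {1 - e} := TwoSidedIdeal.subset_span rfl
    rw [TwoSidedIdeal.mem_iff] at this
    exact ((RingCon.eq _).2 this)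
  have hEe : cornerProj Λ e (E * e) = cornerProj Λ e E := by
    rw [← sub_eq_zero, ← map_sub, show E * e - E = -(E * (1 - e)) by noncomm_ring, map_neg,
      map_mul, hce, mul_zero, neg_zero]
  have hu : IsUnit (1 - cornerProj Λ e E) := by
    have := (h 1).map (cornerProj Λ e)
    rwa [one_mul, map_sub, map_one, hEe] at this
  have hz : (1 - cornerProj Λ e E) * cornerProj Λ e E = (1 - cornerProj Λ e E) * 0 := by
    rw [sub_mul, one_mul, ← map_mul, hE, sub_self, mul_zero]
  exact hu.mul_left_cancel hz

theorem std_bdd {M : Type u} [AddCommGroup M] [Module Λᵐᵒᵖ M] (e : Λ) (R : StdRes Λ M)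
    (h : R.EBounded e) : ∃ K, R.toGRes.Bdd e K := by
  obtain ⟨N, hN⟩ := h
  refine ⟨N, fun i hi x => ?_⟩
  change stdProj (R.E i) at x
  change ∀ j : Fin (R.n i), cornerProj Λ e ((x : Fin (R.n i) → Λ) j) = 0
  intro j
  have h1 : cornerProj Λ e (R.E i j) = 0 :=
    idem_corner_zero e _ (R.idem i j) (by simpa using hN i hi j 1)
  have h2 : R.E i j * (x : Fin (R.n i) → Λ) j = (x : Fin (R.n i) → Λ) j := x.2 j
  rw [← h2, map_mul, h1, zero_mul]

theorem eTraceSum_eq {M : Type u} [AddCommGroup M] [Module Λᵐᵒᵖ M] (e : Λ) (R : StdRes Λ M)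
    (K : ℕ) (hK : R.toGRes.Bdd e K) (L : (i : ℕ) → (stdProj (R.E i) →ₗ[Λᵐᵒᵖ] stdProj (R.E i))) :
    eTraceSum e R L =
      ∑ i ∈ Finset.range K, ((-1 : ℤ)^i) • trV e (R.toGRes.r i) (L i) := by
  unfold eTraceSum
  rw [finsum_eq_sum_of_support_subset (s := Finset.range K)]
  · refine Finset.sum_congr rfl fun i _ => ?_
    rw [trV_std]; rfl
  · intro i hi
    by_contra hcon
    apply hi
    have h0 := trV_eq_zero e (R.toGRes.r i) (L i) (hK i (by simpa using hcon))
    have h1 : HH0.map (cornerProj Λ e) (trP (R.idem i) (L i)) = 0 := by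
      rw [trV_std]; exact h0
    change ((-1 : ℤ)^i) • HH0.map (cornerProj Λ e) (trP (R.idem i) (L i)) = 0
    rw [h1, smul_zero]

/-- The idempotents of the trivial resolution of Λ. -/
def trivE (Λ : Type u) [Ring Λ] (i : ℕ) (_ : Fin 1) : Λ := if i = 0 then 1 else 0

theorem trivE_idem (i : ℕ) (j : Fin 1) : IsIdempotentElem (trivE Λ i j) := by
  unfold trivE; split_ifs
  · exact IsIdempotentElem.one
  · exact IsIdempotentElem.zero

theorem trivE_sub (i : ℕ) (x : stdProj (trivE Λ (i+1))) : x = 0 := by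
  apply Subtype.ext
  funext j
  have := x.2 j
  simp only [trivE, Nat.succ_ne_zero, if_false, zero_mul] at this
  exact this.symm

/-- The trivial resolution of the regular module. -/
def trivRes (Λ : Type u) [Ring Λ] : StdRes Λ Λ where
  n := fun _ => 1
  E := trivE Λ
  idem := trivE_idem
  d := fun _ => 0
  aug := LinearMap.proj 0 ∘ₗ Submodule.subtype _
  surj := fun x => ⟨⟨fun _ => x, fun j => by simp [trivE]⟩, rfl⟩
  exact0 := by
    ext x
    constructor
    · intro hx
      refine ⟨0, ?_⟩
      rw [map_zero]
      apply Subtype.ext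
      funext j
      rw [Subsingleton.elim j 0]
      exact hx.symm
    · rintro ⟨y, rfl⟩
      exact Submodule.zero_mem _
  exact := by
    intro i
    ext x
    constructor
    · intro _
      exact ⟨0, (trivE_sub i x).symm⟩
    · rintro ⟨y, rfl⟩
      exact Submodule.zero_mem _

/-- Left multiplication on the trivial resolution. -/
def trivL (a : Λ) (i : ℕ) : stdProj (trivE Λ i) →ₗ[Λᵐᵒᵖ] stdProj (trivE Λ i) where
  toFun x := ⟨fun j => trivE Λ i j * (a * (x : Fin 1 → Λ) j), fun j => by
    rw [← mul_assoc, trivE_idem i j]⟩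
  map_add' x y := by
    apply Subtype.ext; funext j
    change trivE Λ i j * (a * ((x : Fin 1 → Λ) j + (y : Fin 1 → Λ) j)) =
      trivE Λ i j * (a * (x : Fin 1 → Λ) j) + trivE Λ i j * (a * (y : Fin 1 → Λ) j)
    rw [mul_add, mul_add]
  map_smul' c x := by
    apply Subtype.ext; funext j
    change trivE Λ i j * (a * ((x : Fin 1 → Λ) j * c.unop)) =
      trivE Λ i j * (a * (x : Fin 1 → Λ) j) * c.unop
    simp only [mul_assoc]

end Final
/-- From the proof of Theorem 1.5: let Λ be an artin algebra with radical J, and e an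
idempotent such that S_e = eΛ/eJ has finite injective dimension.  Let a ∈ J (so that a
is nilpotent).  Then the e-trace of left multiplication by a on the regular module Λ —
computed as the alternating sum Σᵢ(-1)ⁱ tr_e(φᵢ) over any lifting {φᵢ} to any e-bounded
projective resolution of Λ — is zero in HH₀(Λ_e); consequently a + Λ(1-e)Λ lies in
[Λ_e, Λ_e]. -/
theorem etrace_leftMul_radical_zero (k : Type u) [CommRing k] [IsArtinianRing k]
    (Λ : Type u) [Ring Λ] [Algebra k Λ] [Module.Finite k Λ]
    (e : Λ) (he : IsIdempotentElem e)
    (hfin : FinInjDim Λ (SeMod Λ e))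
    (a : Λ) (ha : a ∈ Jset Λ) (hnil : IsNilpotent a) :
    (∀ (R : StdRes Λ Λ), R.EBounded e →
      ∀ (L : (i : ℕ) → (stdProj (R.E i) →ₗ[Λᵐᵒᵖ] stdProj (R.E i))),
        R.IsLifting (leftMulMap Λ a) L → eTraceSum e R L = 0) ∧
    cornerProj Λ e a ∈ commSub (corner Λ e) := by
  have iT : IsScalarTower k Λᵐᵒᵖ Λ := ⟨fun c x y => by
    simp [MulOpposite.smul_eq_mul_unop]⟩
  have iN1 : ∀ n : ℕ, IsNoetherian Λᵐᵒᵖ (Fin n → Λ) := fun n =>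
    isNoetherian_of_tower k inferInstance
  have iA1 : ∀ n : ℕ, IsArtinian Λᵐᵒᵖ (Fin n → Λ) := fun n =>
    isArtinian_of_tower k inferInstance
  have iF : Module.Finite k Λᵐᵒᵖ := Module.Finite.equiv (MulOpposite.opLinearEquiv k)
  have iA : IsArtinianRing Λᵐᵒᵖ := isArtinian_of_tower k inferInstance
  have iN : IsNoetherianRing Λᵐᵒᵖ := isNoetherian_of_tower k inferInstance
  have iFin : Module.Finite Λᵐᵒᵖ Λ := Module.Finite.of_restrictScalars_finite k _ _
  have main : ∀ (R : StdRes Λ Λ), R.EBounded e →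
      ∀ (L : (i : ℕ) → (stdProj (R.E i) →ₗ[Λᵐᵒᵖ] stdProj (R.E i))),
        R.IsLifting (leftMulMap Λ a) L → eTraceSum e R L = 0 := by
    intro R hR L hL
    obtain ⟨K, hK⟩ := std_bdd e R hR
    rw [eTraceSum_eq e R K hK L]
    obtain ⟨m, hm⟩ := hnil
    refine nilp_trace_zero e he hfin m Λ (leftMulMap Λ a) (fun x => ?_) R.toGRes K hK L hL
    have : ∀ i : ℕ, (leftMulMap Λ a)^[i] x = a ^ i * x := by
      intro i
      induction i with
      | zero => simp
      | succ i ih =>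
        rw [Function.iterate_succ_apply', ih, pow_succ', mul_assoc]; rfl
    rw [this, hm, zero_mul]
  refine ⟨main, ?_⟩
  have hb : (trivRes Λ).EBounded e := by
    refine ⟨1, fun i hi j x y => ?_⟩
    have : (trivRes Λ).E i j = 0 := if_neg (by omega)
    rw [this]; simp
  have h0 := main (trivRes Λ) hb (trivL a) ⟨fun (x : stdProj (trivE Λ 0)) => by
      change trivE Λ 0 0 * (a * (x : Fin 1 → Λ) 0) = a * (x : Fin 1 → Λ) 0
      simp [trivE], fun i x => by
      change (0 : stdProj (trivE Λ i)) = trivL a i 0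
      rw [map_zero]⟩
  have hK : (trivRes Λ).toGRes.Bdd e 1 := by
    intro i hi x j
    obtain ⟨i, rfl⟩ : ∃ i', i = i' + 1 := ⟨i - 1, by omega⟩
    have : x = 0 := trivE_sub i x
    rw [this]
    exact map_zero _
  replace h0 := (eTraceSum_eq e (trivRes Λ) 1 hK (trivL a)).symm.trans h0
  have h1 : trV e ((trivRes Λ).toGRes.r 0) (trivL a 0) = HH0.mk (cornerProj Λ e a) := by
    change HH0.mk (∑ j : Fin 1, cornerProj Λ e (trivE Λ 0 j * (a * (trivE Λ 0 j *
      (Pi.single j 1 : Fin 1 → Λ) j)))) = _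
    simp [trivE]
  simp only [Finset.sum_range_one, pow_zero, one_smul] at h0
  rw [h1] at h0
  exact (QuotientAddGroup.eq_zero_iff _).1 h0
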